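/- (Furthest graph from a hereditary property via consecutive block models.) Let ℋ be a hereditary property of simple ordered graphs containing at least one graph on n vertices for every n ≥ 1, and let d̄_ℋ = sup_G d₁(G, ℋ), the supremum over all finite simple ordered graphs G. Then for every ε > 0 there exist a positive integer M and a symmetric function B : [M]² → [0,1] such that, with W = W_B the naive M-block orderon of B, the probability (with respect to the product Lebesgue probability measure on [0,1]^n × [0,1]^n × [0,1]^{n(n−1)/2}) that the random ordered graph G(z,y,r;W) on n vertices satisfies d₁(G(z,y,r;W), ℋ) ≥ d̄_ℋ − ε tends to 1 as n → ∞. -/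

import Mathlib

open MeasureTheory Real Filter
open scoped ENNReal Classical

noncomputable section

/-- The unit interval `[0,1]` as a subtype of `ℝ`. -/
abbrev UI : Type := Set.Icc (0:ℝ) 1

/-- The unit square `[0,1]²`. -/
abbrev USq : Type := UI × UI

/-- An orderon: a symmetric measurable function `([0,1]²)² → [0,1]`. -/
def IsOrderon (W : USq → USq → ℝ) : Prop :=
  Measurable (Function.uncurry W) ∧ (∀ u v, W u v ∈ Set.Icc (0:ℝ) 1) ∧
    ∀ u v, W u v = W v u

/-- The (unordered) cut norm: `sup_{S,T} |∫_{S×T} W|` over measurable `S,T ⊆ [0,1]²`. -/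
def cutNorm (W : USq → USq → ℝ) : ℝ :=
  sSup {x | ∃ S T : Set USq, MeasurableSet S ∧ MeasurableSet T ∧
    x = |∫ p in S ×ˢ T, W p.1 p.2|}

/-- A measure-preserving bijection of `[0,1]²` with measure-preserving inverse. -/
def IsMPB (f : USq → USq) : Prop :=
  MeasurePreserving f volume volume ∧
  ∃ g : USq → USq, MeasurePreserving g volume volume ∧
    Function.LeftInverse g f ∧ Function.RightInverse g f

/-- `Shift(f) = sup_{(x,a)} |x - π₁(f(x,a))|`. -/
def shiftOf (f : USq → USq) : ℝ := ⨆ u : USq, |(u.1 : ℝ) - ((f u).1 : ℝ)|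

/-- The cut-shift distance `d△(W,U) = inf_f (Shift(f) + ‖W - U^f‖_□)`. -/
def csDist (W U : USq → USq → ℝ) : ℝ :=
  sInf {x | ∃ f : USq → USq, IsMPB f ∧
    x = shiftOf f + cutNorm (fun u v => W u v - U (f u) (f v))}

/-- `Q_n(z) = ⌈nz⌉` for `z ∈ (0,1]`, and `Q_n(0) = 1`. -/
def Qn (n : ℕ) (x : ℝ) : ℕ := max 1 ⌈(n : ℝ) * x⌉₊

/-- The naive `n`-block orderon of a weighted ordered graph `G : [n]² → [0,1]`
(given as a function `ℕ → ℕ → ℝ`, 1-indexed). -/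
def blockOrderon (n : ℕ) (G : ℕ → ℕ → ℝ) : USq → USq → ℝ :=
  fun u v => G (Qn n (u.1 : ℝ)) (Qn n (v.1 : ℝ))

/-- The (1-indexed, real-valued) adjacency function of a simple ordered graph on `[n]`. -/
def graphAdjFun {n : ℕ} (G : SimpleGraph (Fin n)) : ℕ → ℕ → ℝ :=
  fun i j => if h : i - 1 < n ∧ j - 1 < n then
    (if G.Adj ⟨i - 1, h.1⟩ ⟨j - 1, h.2⟩ then 1 else 0) else 0

/-- The naive block orderon `W_G` representing a simple ordered graph `G` on `[n]`. -/
def graphOrderon {n : ℕ} (G : SimpleGraph (Fin n)) : USq → USq → ℝ :=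
  blockOrderon n (graphAdjFun G)

/-- Index type for the `k(k-1)/2` coordinates `r_{ij}`, `i < j`. -/
abbrev Pairs (k : ℕ) := {p : Fin k × Fin k // p.1 < p.2}

/-- The random ordered graph `G(z,y,r;W)` on `[k]` sampled from an orderon `W`:
sort `z` nondecreasingly via the permutation `σ = Tuple.sort z`, set
`X_i = z_{σ(i)}`, `Y_i = y_{σ(i)}`, and put an edge `{i,j}` (for `i < j`) iff
`r_{ij} ≤ W((X_i,Y_i),(X_j,Y_j))`. -/
def sampleSG (k : ℕ) (W : USq → USq → ℝ) (z y : Fin k → UI) (r : Pairs k → UI) :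
    SimpleGraph (Fin k) :=
  SimpleGraph.fromRel (fun a b =>
    ∃ h : a < b, (r ⟨(a, b), h⟩ : ℝ) ≤
      W (z (Tuple.sort (fun t => (z t : ℝ)) a), y (Tuple.sort (fun t => (z t : ℝ)) a))
        (z (Tuple.sort (fun t => (z t : ℝ)) b), y (Tuple.sort (fun t => (z t : ℝ)) b)))

/-- The induced ordered subgraph of `G` on a `k`-element subset `S` of its vertices,
with the vertices of `S` relabeled by `[k]` in increasing order. -/
def inducedSG {n : ℕ} (G : SimpleGraph (Fin n)) (k : ℕ) (S : Finset (Fin n)) :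
    SimpleGraph (Fin k) :=
  if h : S.card = k then G.comap (fun i => (S.orderIsoOfFin h i : Fin n)) else ⊥

/-- A property of simple ordered graphs (one set of graphs for each number of
vertices) is hereditary if it is closed under taking induced ordered subgraphs. -/
def Hereditary (H : ∀ n, Set (SimpleGraph (Fin n))) : Prop :=
  ∀ (n k : ℕ) (G : SimpleGraph (Fin n)), G ∈ H n → ∀ S : Finset (Fin n), S.card = k →
    inducedSG G k S ∈ H k

/-- Normalized edit (Hamming) distance between two ordered graphs on `[n]`:
`|{(i,j) : G(i,j) ≠ G'(i,j)}| / n²`. -/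
def editDist {n : ℕ} (G G' : SimpleGraph (Fin n)) : ℝ :=
  ((Finset.univ.filter
      (fun p : Fin n × Fin n => ¬ (G.Adj p.1 p.2 ↔ G'.Adj p.1 p.2))).card : ℝ) / (n^2 : ℝ)

/-- Distance of `G` from a set of ordered graphs on the same vertex set. -/
def distToProp {n : ℕ} (G : SimpleGraph (Fin n)) (P : Set (SimpleGraph (Fin n))) : ℝ :=
  sInf {x | ∃ G' ∈ P, x = editDist G G'}

/-- `d̄_ℋ = sup_G d₁(G, ℋ)`, the supremum over all finite simple ordered graphs. -/
def supDistToProp (H : ∀ n, Set (SimpleGraph (Fin n))) : ℝ :=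
  sSup {x | ∃ (n : ℕ) (G : SimpleGraph (Fin n)), x = distToProp G (H n)}

/-- Double counting of tuples by the values of two distinct coordinates. -/
theorem sum_pi_apply_pair {ι : Type*} [Fintype ι] [DecidableEq ι] {α : ι → Type*} [∀ i, Fintype (α i)]
    {i j : ι} (hij : i ≠ j) (F : α i → α j → ℝ) :
    (∑ t : ∀ k, α k, F (t i) (t j)) * ((Fintype.card (α i) : ℝ) * Fintype.card (α j)) =
      (Fintype.card (∀ k, α k) : ℝ) * ∑ a, ∑ b, F a b := by
  let φ : ((∀ k, α k) × α i × α j) → ((∀ k, α k) × α i × α j) :=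
    fun x => (Function.update (Function.update x.1 i x.2.1) j x.2.2, x.1 i, x.1 j)
  have hφ : Function.Involutive φ := by
    rintro ⟨t, a, b⟩
    refine Prod.ext ?_ (Prod.ext ?_ ?_)
    · funext k
      by_cases hkj : k = j
      · subst hkj; simp [φ]
      · by_cases hki : k = i
        · subst hki; simp [φ, hij]
        · simp [φ, hki, hkj]
    · simp [φ, hij]
    · simp [φ]
  have h := Equiv.sum_comp hφ.toPerm
    (fun x : (∀ k, α k) × α i × α j => F x.2.1 x.2.2)
  simp only [Function.Involutive.coe_toPerm, φ, Fintype.sum_prod_type, Finset.sum_const,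
    Finset.card_univ, nsmul_eq_mul] at h
  rw [← h, Finset.sum_mul]
  exact Finset.sum_congr rfl fun t _ => by
    rw [Fintype.card_prod]; push_cast; ring

theorem editDist_mul_sq {n : ℕ} (hn : 0 < n) (G G' : SimpleGraph (Fin n)) :
    editDist G G' * (n : ℝ) ^ 2 =
      ∑ a, ∑ b, if (G.Adj a b ↔ G'.Adj a b) then (0 : ℝ) else 1 := by
  have hn' : (n : ℝ) ^ 2 ≠ 0 := by positivity
  rw [editDist, div_mul_cancel₀ _ hn', Finset.card_filter, Fintype.sum_prod_type]
  push_cast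
  refine Finset.sum_congr rfl fun a _ => Finset.sum_congr rfl fun b _ => ?_
  by_cases h : (G.Adj a b ↔ G'.Adj a b) <;> simp [h]

theorem editDist_nonneg {n : ℕ} (G G' : SimpleGraph (Fin n)) : 0 ≤ editDist G G' := by
  unfold editDist; positivity

theorem distToProp_nonneg {n : ℕ} (G : SimpleGraph (Fin n)) (P : Set (SimpleGraph (Fin n))) :
    0 ≤ distToProp G P := by
  refine Real.sInf_nonneg ?_
  rintro x ⟨G', -, rfl⟩
  exact editDist_nonneg _ _

theorem distToProp_le_editDist {n : ℕ} (G : SimpleGraph (Fin n))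
    {P : Set (SimpleGraph (Fin n))} {G' : SimpleGraph (Fin n)} (h : G' ∈ P) :
    distToProp G P ≤ editDist G G' := by
  refine csInf_le ⟨0, ?_⟩ ⟨G', h, rfl⟩
  rintro x ⟨G'', -, rfl⟩
  exact editDist_nonneg _ _

theorem Hereditary.comap_mem {H : ∀ n, Set (SimpleGraph (Fin n))} (hH : Hereditary H)
    {n m : ℕ} {G : SimpleGraph (Fin n)} (hG : G ∈ H n) {t : Fin m → Fin n}
    (ht : StrictMono t) : G.comap t ∈ H m := by
  have hc : (Finset.univ.image t).card = m := by
    rw [Finset.card_image_of_injective _ ht.injective]; simp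
  have h := hH n m G hG _ hc
  have ht' : t = (Finset.univ.image t).orderEmbOfFin hc :=
    Finset.orderEmbOfFin_unique hc (fun x => by simp) ht
  have he : (fun i => (((Finset.univ.image t).orderIsoOfFin hc i : _) : Fin n)) = t := by
    conv_rhs => rw [ht']
    rfl
  rw [inducedSG, dif_pos hc, he] at h
  exact h

/-- If `S` is a consecutive blow-up of `G` (up to edges inside blocks) with all blocks of size
at least `s`, then `S` is essentially as far from a hereditary property as `G`. -/
theorem distToProp_mul_sq_le_of_blowup {H : ∀ n, Set (SimpleGraph (Fin n))}
    (hH : Hereditary H) {m n : ℕ} (hm : 0 < m) (hn : 0 < n) {G : SimpleGraph (Fin m)}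
    {S G' : SimpleGraph (Fin n)} {blk : Fin n → Fin m} (hblk : Monotone blk)
    (hS : ∀ a b, blk a ≠ blk b → (S.Adj a b ↔ G.Adj (blk a) (blk b)))
    {s : ℝ} (hs : 0 < s) (hcard : ∀ i, s ≤ Fintype.card {a // blk a = i}) (hG' : G' ∈ H n) :
    distToProp G (H m) * (m : ℝ) ^ 2 * s ^ 2 ≤ editDist S G' * (n : ℝ) ^ 2 := by
  set d := distToProp G (H m) * (m : ℝ) ^ 2
  let F : Fin n → Fin n → ℝ := fun a b => if (S.Adj a b ↔ G'.Adj a b) then 0 else 1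
  have hF : ∀ a b, 0 ≤ F a b := fun a b => by dsimp only [F]; split_ifs <;> norm_num
  have htrans : ∀ t : (∀ i, {a // blk a = i}),
      d ≤ ∑ i, ∑ j, if i = j then 0 else F (t i) (t j) := by
    intro t
    have hmono : StrictMono fun i => (t i : Fin n) := by
      intro i j hij
      by_contra hle
      have := hblk (not_lt.1 hle)
      rw [(t i).2, (t j).2] at this
      exact absurd hij (not_lt.2 this)
    refine (mul_le_mul_of_nonneg_right
      (distToProp_le_editDist G (hH.comap_mem hG' hmono)) (sq_nonneg _)).trans ?_
    rw [editDist_mul_sq hm]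
    refine Finset.sum_le_sum fun i _ => Finset.sum_le_sum fun j _ => ?_
    by_cases hij : i = j
    · subst hij; simp
    · have hne : blk (t i) ≠ blk (t j) := by rwa [(t i).2, (t j).2]
      have := hS _ _ hne
      rw [(t i).2, (t j).2] at this
      simp [F, hij, this, SimpleGraph.comap_adj]
  set N : ℝ := (Fintype.card (∀ i, {a // blk a = i}) : ℝ) with hN
  have hNpos : 0 < N := by
    have (i : Fin m) : Nonempty {a // blk a = i} := by
      rw [← Fintype.card_pos_iff]
      exact_mod_cast hs.trans_le (hcard i)
    rw [hN]
    exact_mod_cast Fintype.card_pos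
  have hpair : ∀ i j, (∑ t : (∀ i, {a // blk a = i}), if i = j then 0 else F (t i) (t j)) * s ^ 2 ≤
      N * ∑ a : {a // blk a = i}, ∑ b : {b // blk b = j}, F a b := by
    intro i j
    by_cases hij : i = j
    · simp only [hij, if_true, Finset.sum_const_zero, zero_mul]
      exact mul_nonneg hNpos.le
        (Finset.sum_nonneg fun a _ => Finset.sum_nonneg fun b _ => hF _ _)
    · simp only [hij, if_false]
      rw [hN, ← sum_pi_apply_pair (α := fun i => {a // blk a = i}) hij
        (fun a b => F a b), pow_two]
      refine mul_le_mul_of_nonneg_left ?_ (Finset.sum_nonneg fun t _ => hF _ _)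
      exact mul_le_mul (hcard i) (hcard j) hs.le (Nat.cast_nonneg _)
  have hsum : N * d ≤ ∑ i, ∑ j, ∑ t : (∀ i, {a // blk a = i}),
      if i = j then 0 else F (t i) (t j) := by
    have h := Finset.sum_le_sum fun t (_ : t ∈ (Finset.univ : Finset (∀ i, {a // blk a = i}))) =>
      htrans t
    rw [Finset.sum_const, nsmul_eq_mul, Finset.card_univ, Finset.sum_comm] at h
    refine h.trans_eq (Finset.sum_congr rfl fun i _ => Finset.sum_comm)
  have hfib : ∑ i, ∑ j, ∑ a : {a // blk a = i}, ∑ b : {b // blk b = j}, F a b =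
      ∑ a, ∑ b, F a b := by
    rw [← Fintype.sum_fiberwise blk (fun a => ∑ b, F a b)]
    refine Finset.sum_congr rfl fun i _ => ?_
    rw [Finset.sum_comm]
    refine Finset.sum_congr rfl fun a _ => ?_
    exact Fintype.sum_fiberwise blk (fun b => F a b)
  rw [editDist_mul_sq hn]
  refine le_of_mul_le_mul_left ?_ hNpos
  calc N * (d * s ^ 2) = N * d * s ^ 2 := by ring
    _ ≤ _ := mul_le_mul_of_nonneg_right hsum (sq_nonneg s)
    _ = ∑ i, ∑ j, (∑ t : (∀ i, {a // blk a = i}),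
        if i = j then 0 else F (t i) (t j)) * s ^ 2 := by simp only [Finset.sum_mul]
    _ ≤ ∑ i, ∑ j, N * ∑ a : {a // blk a = i}, ∑ b : {b // blk b = j}, F a b :=
      Finset.sum_le_sum fun i _ => Finset.sum_le_sum fun j _ => hpair i j
    _ = N * ∑ a, ∑ b, F a b := by simp only [← hfib, Finset.mul_sum]

/-- Weak law of large numbers for the number of i.i.d. samples falling into a set. -/
theorem measure_card_mem_le {Ω : Type*} [MeasurableSpace Ω] (μ : Measure Ω)
    [IsProbabilityMeasure μ] {J : Set Ω} (hJ : MeasurableSet J) {c : ℝ} (hc : 0 < c)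
    {n : ℕ} (hn : 0 < n) :
    Measure.pi (fun _ : Fin n => μ)
      {z | (Fintype.card {a // z a ∈ J} : ℝ) ≤ (μ.real J - c) * n} ≤
      ENNReal.ofReal (1 / c ^ 2 * (1 / n)) := by
  set P := Measure.pi (fun _ : Fin n => μ)
  let f : Ω → ℝ := J.indicator 1
  have hfm : Measurable f := measurable_one.indicator hJ
  have hf01 : ∀ x, f x ∈ Set.Icc (0 : ℝ) 1 := fun x => by
    by_cases hx : x ∈ J <;> simp [f, hx]
  have hf2 : MemLp f 2 μ := MemLp.of_bound hfm.aestronglyMeasurable 1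
    (Eventually.of_forall fun x => by
      rw [Real.norm_eq_abs, abs_of_nonneg (hf01 x).1]; exact (hf01 x).2)
  let X : (Fin n → Ω) → ℝ := ∑ a, fun z => f (z a)
  have hXa : ∀ a : Fin n, MemLp (fun z : Fin n → Ω => f (z a)) 2 P := fun a =>
    hf2.comp_measurePreserving (measurePreserving_eval (fun _ : Fin n => μ) a)
  have hX2 : MemLp X 2 P := memLp_finsetSum' _ fun a _ => hXa a
  have hmean : ∫ z, X z ∂P = n * μ.real J := by
    simp only [X, Finset.sum_apply]
    rw [integral_finsetSum _ fun a _ => (hXa a).integrable (by norm_num)]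
    have : ∀ a : Fin n, ∫ z, f (z a) ∂P = μ.real J := fun a => by
      rw [integral_comp_eval (μ := fun _ : Fin n => μ) (f := f) hfm.aestronglyMeasurable]
      exact integral_indicator_one hJ
    simp [this]
  have hvar : ProbabilityTheory.variance X P ≤ n := by
    have h := ProbabilityTheory.variance_sum_pi (μ := fun _ : Fin n => μ)
      (X := fun _ => f) (fun _ => hf2)
    have h1 : ProbabilityTheory.variance f μ ≤ 1 :=
      (ProbabilityTheory.variance_le_sq_of_bounded (Eventually.of_forall hf01)
        hfm.aemeasurable).trans (by norm_num)
    calc _ = _ := h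
      _ ≤ ∑ _a : Fin n, (1 : ℝ) := Finset.sum_le_sum fun _ _ => h1
      _ = n := by simp
  have hn' : (0 : ℝ) < n := by exact_mod_cast hn
  refine (measure_mono ?_).trans ((ProbabilityTheory.meas_ge_le_variance_div_sq hX2
    (mul_pos hc hn')).trans (ENNReal.ofReal_le_ofReal ?_))
  · intro z hz
    have hXz : X z = Fintype.card {a // z a ∈ J} := by
      simp [X, f, Set.indicator_apply, Fintype.card_subtype]
    simp only [Set.mem_ofPred_eq] at hz ⊢
    rw [hmean, hXz, abs_sub_comm]
    exact le_trans (by linarith) (le_abs_self _)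
  · calc _ ≤ (n : ℝ) / (c * n) ^ 2 := by gcongr
      _ = _ := by field_simp

theorem Qn_eq_of_mem_Ioc {m i : ℕ} {x : ℝ} (hm : 0 < m) (h₁ : (i : ℝ) / m < x)
    (h₂ : x ≤ (i + 1 : ℝ) / m) : Qn m x = i + 1 := by
  have hm' : (0 : ℝ) < m := by exact_mod_cast hm
  rw [div_lt_iff₀ hm'] at h₁
  rw [le_div_iff₀ hm'] at h₂
  have : ⌈(m : ℝ) * x⌉₊ = i + 1 := by
    rw [Nat.ceil_eq_iff (by omega)]
    push_cast
    constructor <;> linarith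
  simp [Qn, this]

theorem Qn_mono (m : ℕ) : Monotone (Qn m) := fun x y h => by
  unfold Qn; gcongr

/-- The zero-based index of the block of `[0,1]` containing a point. -/
def blockIndex {m : ℕ} (hm : 0 < m) (x : UI) : Fin m :=
  ⟨Qn m x - 1, by
    have : ⌈(m : ℝ) * x⌉₊ ≤ m := Nat.ceil_le.2 (mul_le_of_le_one_right (Nat.cast_nonneg m) x.2.2)
    unfold Qn
    omega⟩

theorem blockIndex_mono {m : ℕ} (hm : 0 < m) : Monotone (blockIndex hm) := fun _ _ h =>
  Nat.sub_le_sub_right (Qn_mono m h) 1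

/-- Each block contains an interval of length `1 / m`. -/
theorem exists_subset_blockIndex_fiber {m : ℕ} (hm : 0 < m) (i : Fin m) :
    ∃ J : Set UI, MeasurableSet J ∧ (volume : Measure UI).real J = 1 / m ∧
      ∀ x ∈ J, blockIndex hm x = i := by
  have hm' : (0 : ℝ) < m := by exact_mod_cast hm
  have hi : (i : ℝ) + 1 ≤ m := by exact_mod_cast i.2
  have hi0 : (0 : ℝ) ≤ i := Nat.cast_nonneg _
  let u : UI := ⟨(i : ℝ) / m, by positivity, by rw [div_le_one hm']; linarith⟩
  let v : UI := ⟨((i : ℝ) + 1) / m, by positivity, by rw [div_le_one hm']; linarith⟩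
  refine ⟨Set.Ioc u v, measurableSet_Ioc, ?_, fun x hx => Fin.ext ?_⟩
  · rw [Measure.real, unitInterval.volume_Ioc, ENNReal.toReal_ofReal] <;> simp only [u, v]
    · field_simp; ring
    · rw [← sub_div]; apply div_nonneg <;> linarith
  · have : Qn m x = i + 1 := Qn_eq_of_mem_Ioc hm hx.1 hx.2
    simp [blockIndex, this]

theorem sampleSG_graphAdjFun_adj {m n : ℕ} (hm : 0 < m) (G : SimpleGraph (Fin m))
    (z y : Fin n → UI) {r : Pairs n → UI} (hr : ∀ p, r p ≠ 0) (a b : Fin n) (hab : a ≠ b) :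
    (sampleSG n (blockOrderon m (graphAdjFun G)) z y r).Adj a b ↔
      G.Adj (blockIndex hm (z (Tuple.sort (fun t => (z t : ℝ)) a)))
        (blockIndex hm (z (Tuple.sort (fun t => (z t : ℝ)) b))) := by
  have key : ∀ (p : Pairs n) (x x' : USq),
      (r p : ℝ) ≤ blockOrderon m (graphAdjFun G) x x' ↔
        G.Adj (blockIndex hm x.1) (blockIndex hm x'.1) := by
    intro p x x'
    have hpos : (0 : ℝ) < r p := lt_of_le_of_ne (r p).2.1 fun h => hr p (Subtype.ext h.symm)
    rw [blockOrderon, graphAdjFun, dif_pos ⟨(blockIndex hm x.1).2, (blockIndex hm x'.1).2⟩]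
    change _ ≤ (if G.Adj (blockIndex hm x.1) (blockIndex hm x'.1) then (1 : ℝ) else 0) ↔ _
    split_ifs with h
    · simpa [h] using (r p).2.2
    · simpa [h] using hpos
  simp only [sampleSG, SimpleGraph.fromRel_adj, key]
  rcases lt_or_gt_of_ne hab with h | h
  · simp [h, hab, h.le]
  · simp [h, hab, h.le, G.adj_comm]

theorem graphAdjFun_mem_Icc {m : ℕ} (G : SimpleGraph (Fin m)) (i j : ℕ) :
    graphAdjFun G i j ∈ Set.Icc (0 : ℝ) 1 := by
  unfold graphAdjFun
  split_ifs <;> simp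

theorem graphAdjFun_symm {m : ℕ} (G : SimpleGraph (Fin m)) (i j : ℕ) :
    graphAdjFun G i j = graphAdjFun G j i := by
  unfold graphAdjFun
  by_cases h : i - 1 < m ∧ j - 1 < m
  · rw [dif_pos h, dif_pos h.symm]
    exact if_congr (G.adj_comm _ _) rfl rfl
  · rw [dif_neg h, dif_neg fun h' => h h'.symm]

/-- Some nonempty ordered graph is nearly as far as possible from `H`. -/
theorem exists_supDistToProp_sub_lt (H : ∀ n, Set (SimpleGraph (Fin n))) {ε : ℝ} (hε : 0 < ε) :
    ∃ (m : ℕ) (_ : 0 < m) (G : SimpleGraph (Fin m)),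
      supDistToProp H - ε < distToProp G (H m) := by
  obtain ⟨x, ⟨m, G, rfl⟩, hx⟩ := exists_lt_of_lt_csSup
    (s := {x | ∃ (n : ℕ) (G : SimpleGraph (Fin n)), x = distToProp G (H n)})
    ⟨_, 0, ⊥, rfl⟩ (sub_lt_self (supDistToProp H) hε)
  rcases Nat.eq_zero_or_pos m with rfl | hm
  · refine ⟨1, one_pos, ⊥, hx.trans_le ((?_ : _ ≤ (0 : ℝ)).trans (distToProp_nonneg _ _))⟩
    refine Real.sInf_nonpos ?_
    rintro x ⟨G', -, rfl⟩
    simp [editDist]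
  · exact ⟨m, hm, G, hx⟩

/-- With high probability every block receives nearly its expected number of samples. -/
theorem tendsto_measure_blockIndex_card {m : ℕ} (hm : 0 < m) {c : ℝ} (hc : 0 < c) :
    Tendsto (fun n : ℕ => (volume : Measure (Fin n → UI))
      {z | ∃ i : Fin m, (Fintype.card {a // blockIndex hm (z a) = i} : ℝ) ≤ (1 / m - c) * n})
      atTop (nhds 0) := by
  have hlim : Tendsto (fun n : ℕ => (m : ℝ≥0∞) * ENNReal.ofReal (1 / c ^ 2 * (1 / n)))
      atTop (nhds 0) := by
    have h := (ENNReal.tendsto_ofReal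
      ((tendsto_one_div_atTop_nhds_zero_nat (𝕜 := ℝ)).const_mul (1 / c ^ 2)))
    have h2 := ENNReal.Tendsto.const_mul (a := (m : ℝ≥0∞)) h (Or.inr (ENNReal.natCast_ne_top m))
    simpa using h2
  refine tendsto_of_tendsto_of_tendsto_of_le_of_le' tendsto_const_nhds hlim
    (Eventually.of_forall fun n => zero_le) ?_
  filter_upwards [eventually_gt_atTop 0] with n hn
  rw [Set.ofPred_exists]
  refine (measure_iUnion_fintype_le _ _).trans ?_
  refine (Finset.sum_le_sum (g := fun _ => ENNReal.ofReal (1 / c ^ 2 * (1 / n)))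
    fun i _ => ?_).trans_eq (by simp)
  obtain ⟨J, hJ, hJm, hJi⟩ := exists_subset_blockIndex_fiber hm i
  refine (measure_mono fun z hz => ?_).trans (measure_card_mem_le volume hJ hc hn)
  simp only [Set.mem_ofPred_eq] at hz ⊢
  rw [hJm]
  refine le_trans ?_ hz
  exact_mod_cast Fintype.card_subtype_mono _ _ fun a ha => hJi _ ha

/-- The furthest ordered graph from a hereditary property via consecutive stochastic
block models: for every hereditary `ℋ` (nonempty at every size) and `ε > 0` there is a
weighted ordered graph `B` on `M` vertices such that a random ordered graph on `n`
vertices sampled from the naive `M`-block orderon `W_B` (i.e. generated by a consecutive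
stochastic block model with `M` equal blocks) is `(d̄_ℋ - ε)`-far from `ℋ` with
probability tending to `1` as `n → ∞`. -/
theorem furthest_graph_from_hereditary_property
    (H : ∀ n, Set (SimpleGraph (Fin n))) (hH : Hereditary H)
    (hne : ∀ n : ℕ, 1 ≤ n → (H n).Nonempty)
    (ε : ℝ) (hε : 0 < ε) :
    ∃ M : ℕ, 0 < M ∧ ∃ B : ℕ → ℕ → ℝ,
      (∀ i j, B i j ∈ Set.Icc (0:ℝ) 1) ∧ (∀ i j, B i j = B j i) ∧
      Tendsto (fun n : ℕ =>
          volume {p : (Fin n → UI) × (Fin n → UI) × (Pairs n → UI) |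
            supDistToProp H - ε ≤
              distToProp (sampleSG n (blockOrderon M B) p.1 p.2.1 p.2.2) (H n)})
        atTop (nhds 1) := by
  obtain ⟨m, hm, G, hG⟩ := exists_supDistToProp_sub_lt H (half_pos hε)
  set d := distToProp G (H m) with hd
  have hd0 : 0 ≤ d := distToProp_nonneg _ _
  have hm' : (0 : ℝ) < m := by exact_mod_cast hm
  refine ⟨m, hm, graphAdjFun G, graphAdjFun_mem_Icc G, graphAdjFun_symm G, ?_⟩
  obtain ⟨δ, hδ0, hδ1, hδd⟩ : ∃ δ : ℝ, 0 < δ ∧ δ < 1 ∧ d - ε / 2 ≤ d * (1 - δ) ^ 2 := by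
    refine ⟨min (1 / 2) (ε / (4 * (d + 1))), by positivity,
      (min_le_left _ _).trans_lt (by norm_num), ?_⟩
    have h1 : min (1 / 2) (ε / (4 * (d + 1))) * (4 * (d + 1)) ≤ ε := by
      rw [← le_div_iff₀ (by positivity)]; exact min_le_right _ _
    have h2 : 0 < min (1 / 2) (ε / (4 * (d + 1))) := by positivity
    nlinarith [mul_nonneg hd0 (sq_nonneg (min (1 / 2) (ε / (4 * (d + 1)))))]
  have hlim := tendsto_measure_blockIndex_card hm (div_pos hδ0 hm')
  have hlim' := ENNReal.Tendsto.sub (tendsto_const_nhds (x := (1 : ℝ≥0∞))) hlim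
    (Or.inl ENNReal.one_ne_top)
  rw [tsub_zero] at hlim'
  refine tendsto_of_tendsto_of_tendsto_of_le_of_le' hlim'
    tendsto_const_nhds ?_ (Eventually.of_forall fun n => prob_le_one)
  filter_upwards [eventually_gt_atTop 0] with n hn
  have hn' : (0 : ℝ) < n := by exact_mod_cast hn
  set A : Set (Fin n → UI) :=
    {z | ∃ i : Fin m, (Fintype.card {a // blockIndex hm (z a) = i} : ℝ) ≤ (1 / m - δ / m) * n}
  have hR : (volume : Measure (Pairs n → UI)) {r | ∀ p, r p ≠ 0} = 1 := by
    have hae : ∀ᵐ r : Pairs n → UI, ∀ p, r p ≠ 0 := ae_all_iff.2 fun p =>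
      (measurePreserving_eval (fun _ : Pairs n => (volume : Measure UI)) p).quasiMeasurePreserving.ae
        (compl_mem_ae_iff.2 (measure_singleton 0))
    rw [measure_congr (eventuallyEq_univ.2 hae), measure_univ]
  have hAc : 1 - (volume : Measure (Fin n → UI)) A ≤ volume Aᶜ := by
    rw [tsub_le_iff_left, ← measure_univ (μ := (volume : Measure (Fin n → UI))),
      ← Set.union_compl_self A]
    exact measure_union_le _ _
  calc _ ≤ (volume : Measure (Fin n → UI)) Aᶜ := hAc
    _ = volume (Aᶜ ×ˢ ((Set.univ : Set (Fin n → UI)) ×ˢ {r : Pairs n → UI | ∀ p, r p ≠ 0})) := by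
      rw [Measure.volume_eq_prod, Measure.prod_prod, Measure.volume_eq_prod,
        Measure.prod_prod, hR]
      simp
    _ ≤ _ := measure_mono ?_
  rintro ⟨z, y, r⟩ ⟨hz, -, hr⟩
  simp only [A, Set.mem_compl_iff, Set.mem_ofPred_eq, not_exists, not_le] at hz hr ⊢
  set σ := Tuple.sort (fun t => (z t : ℝ))
  have hs : 0 < (1 / m - δ / m) * (n : ℝ) := by
    rw [← sub_div]
    exact mul_pos (div_pos (sub_pos.2 hδ1) hm') hn'
  refine le_csInf ?_ ?_
  · obtain ⟨G', hG'⟩ := hne n hn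
    exact ⟨_, G', hG', rfl⟩
  rintro x ⟨G', hG', rfl⟩
  have h := distToProp_mul_sq_le_of_blowup hH hm hn (G := G)
    (S := sampleSG n (blockOrderon m (graphAdjFun G)) z y r) (G' := G')
    (blk := fun a => blockIndex hm (z (σ a)))
    (fun a b hab => blockIndex_mono hm (Tuple.monotone_sort (fun t => (z t : ℝ)) hab))
    (fun a b hab => sampleSG_graphAdjFun_adj hm G z y hr a b fun h => hab (by rw [h]))
    hs (fun i => (hz i).le.trans_eq (by
      exact_mod_cast (Fintype.card_congr (σ.subtypeEquiv fun a => Iff.rfl)).symm)) hG'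
  have h' : d * (m : ℝ) ^ 2 * ((1 / m - δ / m) * n) ^ 2 = d * (1 - δ) ^ 2 * n ^ 2 := by
    field_simp
  rw [← hd, h'] at h
  have := le_of_mul_le_mul_right h (by positivity)
  linarith
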